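/- Let K be a number field, f ∈ K[X] of degree d ≥ 2, α ∈ K, and n ≥ 1. Suppose f^n − α is separable and its splitting field K_f^n(α) over K has degree (d!)^{(d^n−1)/(d−1)} over K (the maximal possible, i.e., Gal_f^n(α) ≅ W_n(d), the n-fold iterated wreath product of S_d). Let L = K(√disc(f − α), √disc(f^2 − α), …, √disc(f^n − α)) ⊆ K_f^n(α). Then [L : K] = 2^n, and every intermediate field K ⊆ M ⊆ K_f^n(α) with [M : K] = 2 satisfies M ⊆ L. -/

import Mathlib

open Polynomial

noncomputable section

namespace Arb

/-- The `n`-fold composite `f^n` of a polynomial (`f^0 = X`). -/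
def fIter {K : Type} [Field K] (f : K[X]) : ℕ → K[X]
  | 0 => X
  | n + 1 => f.comp (fIter f n)

/-- The product `∏_{i < j} (r_i - r_j)^2` over the entries of a list. -/
def pairProd {F : Type} [Field F] (l : List F) : F :=
  ∏ i ∈ Finset.range l.length, ∏ j ∈ Finset.range i, (l.getD i 0 - l.getD j 0) ^ 2

/-- The discriminant of a polynomial `p` of degree `N` with leading coefficient `c` and roots
`r_1, …, r_N` (listed with multiplicity) in an algebraic closure of `K`:
`disc p = c^{2N-2} · ∏_{i<j} (r_i - r_j)^2`, computed in the algebraic closure. -/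
def polyDisc {K : Type} [Field K] (p : K[X]) : AlgebraicClosure K :=
  algebraMap K (AlgebraicClosure K) p.leadingCoeff ^ (2 * p.natDegree - 2) *
    pairProd ((p.map (algebraMap K (AlgebraicClosure K))).roots).toList

section LevelActions

open Equiv MulAction

variable {G : Type*} [Group G] {V : ℕ → Type*} [∀ i, MulAction G (V i)]

/-- The subgroup of elements acting trivially on the `i`-th level of a levelwise action. -/
def levelKer (G : Type*) [Group G] (V : ℕ → Type*) [∀ i, MulAction G (V i)] (i : ℕ) :
    Subgroup G :=
  (toPermHom G (V i)).ker

theorem mem_levelKer {i : ℕ} {g : G} : g ∈ levelKer G V i ↔ ∀ x : V i, g • x = x := by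
  simp [levelKer, MonoidHom.mem_ker, Equiv.ext_iff]

/-- The sign of the permutation induced on the `i`-th level. -/
noncomputable def levelSign (G : Type*) [Group G] (V : ℕ → Type*) [∀ i, MulAction G (V i)]
    [∀ i, Fintype (V i)] [∀ i, DecidableEq (V i)] (i : ℕ) : G →* ℤˣ :=
  Perm.sign.comp (toPermHom G (V i))

theorem levelSign_apply [∀ i, Fintype (V i)] [∀ i, DecidableEq (V i)] (i : ℕ) (g : G) :
    levelSign G V i g = Perm.sign (toPermHom G (V i) g) := rfl

theorem levelSign_eq_one_of_mem [∀ i, Fintype (V i)] [∀ i, DecidableEq (V i)] {i : ℕ} {g : G}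
    (hg : g ∈ levelKer G V i) : levelSign G V i g = 1 := by
  rw [levelSign_apply, (MonoidHom.mem_ker).1 hg, map_one]

variable {p : ∀ i, V (i + 1) → V i} (hp : ∀ i (g : G) x, p i (g • x) = g • p i x)

include hp in
theorem levelKer_succ_le {i : ℕ} (hsurj : Function.Surjective (p i)) :
    levelKer G V (i + 1) ≤ levelKer G V i := by
  intro g hg
  rw [mem_levelKer] at hg ⊢
  intro x
  obtain ⟨y, rfl⟩ := hsurj x
  rw [← hp, hg]

variable [∀ i, Fintype (V i)] [∀ i, DecidableEq (V i)]

theorem card_fiberwise_perm {i d : ℕ} (hfib : ∀ x, Fintype.card {y // p i y = x} = d) :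
    Fintype.card {π : Perm (V (i + 1)) // p i ∘ π = p i} = d.factorial ^ Fintype.card (V i) := by
  rw [DomMulAct.stabilizer_card]
  simp [hfib]

theorem card_level [Unique (V 0)] {n d : ℕ}
    (hfib : ∀ i < n, ∀ x, Fintype.card {y // p i y = x} = d) {i : ℕ} (hi : i ≤ n) :
    Fintype.card (V i) = d ^ i := by
  induction i with
  | zero => simp
  | succ i ih =>
    rw [Fintype.card_congr (Equiv.sigmaFiberEquiv (p i)).symm, Fintype.card_sigma]
    simp [hfib i hi, ih (by omega), pow_succ]

omit [∀ i, Fintype (V i)] [∀ i, DecidableEq (V i)] in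
include hp in
theorem map_levelKer_subset (i : ℕ) :
    ((levelKer G V i).map (toPermHom G (V (i + 1))) : Set (Perm (V (i + 1)))) ⊆
      {π | p i ∘ π = p i} := by
  rintro _ ⟨g, hg, rfl⟩
  ext x
  simp [hp, mem_levelKer.1 hg]

include hp in
theorem relIndex_levelKer_le {i d : ℕ} (hfib : ∀ x, Fintype.card {y // p i y = x} = d) :
    (levelKer G V (i + 1)).relIndex (levelKer G V i) ≤ d.factorial ^ Fintype.card (V i) := by
  rw [← card_fiberwise_perm hfib, levelKer, Subgroup.relIndex_ker, ← Nat.card_eq_fintype_card]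
  exact Nat.card_mono (Set.toFinite _) (map_levelKer_subset hp i)

omit [∀ i, Fintype (V i)] [∀ i, DecidableEq (V i)] in
theorem index_levelKer [Unique (V 0)] {n : ℕ}
    (hle : ∀ i < n, levelKer G V (i + 1) ≤ levelKer G V i) :
    (levelKer G V n).index =
      ∏ i ∈ Finset.range n, (levelKer G V (i + 1)).relIndex (levelKer G V i) := by
  induction n with
  | zero =>
    rw [Finset.prod_range_zero, Subgroup.index_eq_one, eq_top_iff]
    exact fun g _ => mem_levelKer.2 fun x => Subsingleton.elim _ _
  | succ n ih =>
    rw [Finset.prod_range_succ, ← ih fun i hi => hle i (by omega), mul_comm,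
      Subgroup.relIndex_mul_index (hle n (by omega))]

theorem surjective_of_card_fiber {i d : ℕ} (hd : 0 < d)
    (hfib : ∀ x, Fintype.card {y // p i y = x} = d) : Function.Surjective (p i) := by
  intro x
  obtain ⟨y, hy⟩ := Fintype.card_pos_iff.1 (hd.trans_eq (hfib x).symm)
  exact ⟨y, hy⟩

include hp in
theorem levelKer_le {n d : ℕ} (hd : 0 < d)
    (hfib : ∀ i < n, ∀ x, Fintype.card {y // p i y = x} = d) {j k : ℕ} (hjk : j ≤ k)
    (hk : k ≤ n) : levelKer G V k ≤ levelKer G V j := by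
  induction k, hjk using Nat.le_induction with
  | base => exact le_rfl
  | succ k hjk ih =>
    exact (levelKer_succ_le hp (surjective_of_card_fiber hd (hfib k (by omega)))).trans
      (ih (by omega))

include hp in
/-- If the action on level `n` has the maximal possible order, every fibrewise permutation of a
level is induced by an element acting trivially on the level below. -/
theorem exists_mem_levelKer [Unique (V 0)] {n d : ℕ} (hd : 0 < d)
    (hfib : ∀ i < n, ∀ x, Fintype.card {y // p i y = x} = d)
    (hmax : (levelKer G V n).index = ∏ i ∈ Finset.range n, d.factorial ^ d ^ i)
    {i : ℕ} (hi : i < n) {π : Perm (V (i + 1))} (hπ : p i ∘ π = p i) :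
    ∃ g ∈ levelKer G V i, ∀ x, g • x = π x := by
  have hle : ∀ j < n, (levelKer G V (j + 1)).relIndex (levelKer G V j) ≤ d.factorial ^ d ^ j := by
    intro j hj
    rw [← card_level hfib hj.le]
    exact relIndex_levelKer_le hp (hfib j hj)
  rw [index_levelKer fun j hj =>
    levelKer_succ_le hp (surjective_of_card_fiber hd (hfib j hj))] at hmax
  have heq : (levelKer G V (i + 1)).relIndex (levelKer G V i) = d.factorial ^ d ^ i := by
    refine (hle i hi).eq_of_not_lt fun hlt => ?_
    refine (Finset.prod_lt_prod (s := Finset.range n) (fun j hj => ?_)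
      (fun j hj => hle j (Finset.mem_range.1 hj)) ⟨i, Finset.mem_range.2 hi, hlt⟩).ne hmax
    refine Nat.pos_of_ne_zero fun h0 => ?_
    rw [Finset.prod_eq_zero hj h0] at hmax
    exact (Finset.prod_pos fun k _ => pow_pos d.factorial_pos _).ne hmax
  rw [← card_level hfib hi.le, ← card_fiberwise_perm (hfib i hi), levelKer,
    Subgroup.relIndex_ker, ← Nat.card_eq_fintype_card] at heq
  have hset := Set.eq_of_subset_of_ncard_le (map_levelKer_subset hp i) heq.ge (Set.toFinite _)
  obtain ⟨g, hg, rfl⟩ := hset.ge hπ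
  exact ⟨g, hg, fun x => rfl⟩

/-- The transpositions within fibres of level `i + 1` over level `i`, for `i < n`, are all induced
by elements acting trivially on level `i`. -/
def RealizesSwaps (G : Type*) [Group G] {V : ℕ → Type*} [∀ i, MulAction G (V i)]
    [∀ i, DecidableEq (V i)] (p : ∀ i, V (i + 1) → V i) (n : ℕ) : Prop :=
  ∀ i < n, ∀ x y : V (i + 1), p i x = p i y →
    ∃ g ∈ levelKer G V i, ∀ z, g • z = swap x y z

include hp in
theorem realizesSwaps_of_index_eq [Unique (V 0)] {n d : ℕ} (hd : 0 < d)
    (hfib : ∀ i < n, ∀ x, Fintype.card {y // p i y = x} = d)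
    (hmax : (levelKer G V n).index = ∏ i ∈ Finset.range n, d.factorial ^ d ^ i) :
    RealizesSwaps G p n := by
  intro i hi x y hxy
  refine exists_mem_levelKer hp hd hfib hmax hi ?_
  ext z
  by_cases hx : z = x
  · simp [hx, hxy]
  by_cases hy : z = y
  · simp [hy, hxy]
  simp [swap_apply_of_ne_of_ne hx hy]

namespace RealizesSwaps

variable {n : ℕ} (h : RealizesSwaps G p n)

omit [∀ i, Fintype (V i)] in
include hp h in
theorem exists_smul_eq [Unique (V 0)] {i : ℕ} (hi : i ≤ n) (x y : V i) : ∃ g : G, g • x = y := by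
  induction i with
  | zero => exact ⟨1, Subsingleton.elim _ _⟩
  | succ i ih =>
    obtain ⟨g, hg⟩ := ih (by omega) (p i x) (p i y)
    obtain ⟨t, -, ht⟩ := h i hi (g • x) y (by rw [hp, hg])
    exact ⟨t * g, by rw [mul_smul, ht, swap_apply_left]⟩

omit [∀ i, Fintype (V i)] in
include hp h in
theorem exists_smul_eq_and_smul_eq [Unique (V 0)] {i : ℕ} (hi : i < n) {x y x' y' : V (i + 1)}
    (hxy : p i x = p i y) (hne : x ≠ y) (hxy' : p i x' = p i y') (hne' : x' ≠ y') :
    ∃ g : G, g • x = x' ∧ g • y = y' := by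
  obtain ⟨g, hg⟩ := h.exists_smul_eq hp (i := i + 1) hi x x'
  obtain ⟨t, -, ht⟩ := h i hi (g • y) y' (by rw [hp, ← hxy, ← hp, hg, hxy'])
  refine ⟨t * g, ?_, ?_⟩
  · rw [mul_smul, ht, hg, swap_apply_of_ne_of_ne _ hne']
    rw [← hg]
    exact (MulAction.injective g).ne hne
  · rw [mul_smul, ht, swap_apply_left]

omit [∀ i, Fintype (V i)] in
include hp h in
/-- Characters trivial on `levelKer G V (i + 1)` take a common value on all transpositions. -/
theorem apply_eq_apply [Unique (V 0)] {i : ℕ} (hi : i < n) {χ : G →* ℤˣ}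
    (hχ : levelKer G V (i + 1) ≤ χ.ker) {x y x' y' : V (i + 1)}
    (hxy : p i x = p i y) (hne : x ≠ y) (hxy' : p i x' = p i y') (hne' : x' ≠ y') {t t' : G}
    (ht : ∀ z, t • z = swap x y z) (ht' : ∀ z, t' • z = swap x' y' z) : χ t = χ t' := by
  obtain ⟨g, rfl, rfl⟩ := h.exists_smul_eq_and_smul_eq hp hi hxy hne hxy' hne'
  have hk : g * t * g⁻¹ * t'⁻¹ ∈ levelKer G V (i + 1) := by
    refine mem_levelKer.2 fun z => ?_
    obtain ⟨w, rfl⟩ : ∃ w, z = t' • w := ⟨t'⁻¹ • z, by simp⟩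
    obtain ⟨w, rfl⟩ : ∃ v, w = g • v := ⟨g⁻¹ • w, by simp⟩
    rw [ht']
    simp only [mul_smul, ← ht', inv_smul_smul, ht]
    rw [ht']
    exact (MulAction.injective g).map_swap x y w
  have h1 := hχ hk
  rw [MonoidHom.mem_ker] at h1
  simp only [map_mul, map_inv] at h1
  rw [mul_right_comm (χ g), mul_inv_cancel, one_mul, mul_inv_eq_one] at h1
  exact h1

include hp h in
/-- Characters vanishing on the elements inducing transpositions in a level vanish on the kernel of
the level below. -/
theorem eq_one_of_swaps {i : ℕ} (hi : i < n) {χ : G →* ℤˣ}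
    (hχ : levelKer G V (i + 1) ≤ χ.ker)
    (hswap : ∀ x y : V (i + 1), p i x = p i y → x ≠ y → ∀ t ∈ levelKer G V i,
      (∀ z, t • z = swap x y z) → χ t = 1) :
    levelKer G V i ≤ χ.ker := by
  intro g hg
  induction hm : (toPermHom G (V (i + 1)) g).support.card using Nat.strong_induction_on
    generalizing g with
  | _ m ih =>
    by_cases hfix : ∀ x : V (i + 1), g • x = x
    · exact hχ (mem_levelKer.2 hfix)
    push Not at hfix
    obtain ⟨x, hx⟩ := hfix
    have hpx : p i x = p i (g • x) := by rw [hp, mem_levelKer.1 hg]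
    obtain ⟨t, htk, ht⟩ := h i hi x (g • x) hpx
    have hperm : toPermHom G (V (i + 1)) (t * g) =
        swap x (g • x) * toPermHom G (V (i + 1)) g := by
      ext z
      simp [mul_smul, ht]
    have hlt : (toPermHom G (V (i + 1)) (t * g)).support.card < m := by
      rw [← hm, hperm]
      exact Perm.card_support_swap_mul (f := toPermHom G (V (i + 1)) g) hx
    have := ih _ hlt (mul_mem htk hg) rfl
    rw [MonoidHom.mem_ker, map_mul, hswap x _ hpx (Ne.symm hx) t htk ht, one_mul] at this
    exact this

theorem levelSign_swap {i : ℕ} {x y : V (i + 1)} (hne : x ≠ y) {t : G}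
    (ht : ∀ z, t • z = swap x y z) : levelSign G V (i + 1) t = -1 := by
  rw [levelSign_apply, show toPermHom G (V (i + 1)) t = swap x y from Equiv.ext ht,
    Perm.sign_swap hne]

include hp h in
theorem eq_one_of_levelSign [Unique (V 0)] {i : ℕ} (hi : i ≤ n) {χ : G →* ℤˣ}
    (hχ : levelKer G V i ≤ χ.ker) {g : G} (hg : ∀ j < i, levelSign G V (j + 1) g = 1) :
    χ g = 1 := by
  induction i generalizing χ with
  | zero => exact hχ (mem_levelKer.2 fun x => Subsingleton.elim _ _)
  | succ i ih =>
    have hg' : ∀ j < i, levelSign G V (j + 1) g = 1 := fun j hj => hg j (by omega)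
    by_cases htriv : levelKer G V i ≤ χ.ker
    · exact ih (by omega) htriv hg'
    have hprod : levelKer G V i ≤ (χ * levelSign G V (i + 1)).ker := by
      refine h.eq_one_of_swaps hp hi (fun k hk => ?_) fun x y hxy hne t _ ht => ?_
      · rw [MonoidHom.mem_ker, MonoidHom.mul_apply, levelSign_eq_one_of_mem hk,
          MonoidHom.mem_ker.1 (hχ hk), one_mul]
      · rw [MonoidHom.mul_apply, levelSign_swap hne ht]
        rcases Int.units_eq_one_or (χ t) with h1 | h1
        · refine absurd (h.eq_one_of_swaps hp hi hχ fun x' y' hxy' hne' t' _ ht' => ?_) htriv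
          rw [← h1]
          exact (h.apply_eq_apply hp hi hχ hxy hne hxy' hne' ht ht').symm
        · simp [h1]
    have := ih (by omega) hprod hg'
    rwa [MonoidHom.mul_apply, hg i (by omega), mul_one] at this

include hp h in
/-- The signs on the levels `1, …, n` are independent. -/
theorem exists_levelSign_eq {d : ℕ} (hd : 2 ≤ d)
    (hfib : ∀ i < n, ∀ x, Fintype.card {y // p i y = x} = d) [Unique (V 0)]
    (ε : ℕ → ℤˣ) {i : ℕ} (hi : i ≤ n) :
    ∃ g : G, ∀ j < i, levelSign G V (j + 1) g = ε j := by
  induction i with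
  | zero => exact ⟨1, fun j hj => by omega⟩
  | succ i ih =>
    obtain ⟨g, hg⟩ := ih (by omega)
    by_cases hgi : levelSign G V (i + 1) g = ε i
    · refine ⟨g, fun j hj => ?_⟩
      obtain hj | rfl := Nat.lt_succ_iff_lt_or_eq.1 hj
      exacts [hg j hj, hgi]
    obtain ⟨v⟩ : Nonempty (V i) := by
      rw [← Fintype.card_pos_iff, card_level hfib (by omega)]
      positivity
    obtain ⟨⟨x, hx⟩, ⟨y, hy⟩, hxy⟩ :=
      Fintype.one_lt_card_iff.1 (show 1 < Fintype.card {y // p i y = v} by rw [hfib i hi]; omega)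
    have hne : x ≠ y := fun h => hxy (Subtype.ext h)
    obtain ⟨t, htk, ht⟩ := h i hi x y (hx.trans hy.symm)
    refine ⟨t * g, fun j hj => ?_⟩
    rw [map_mul]
    obtain hj | rfl := Nat.lt_succ_iff_lt_or_eq.1 hj
    · rw [levelSign_eq_one_of_mem (levelKer_le hp (by omega) hfib hj (by omega) htk), one_mul, hg j hj]
    · rw [levelSign_swap hne ht]
      rcases Int.units_eq_one_or (levelSign G V (j + 1) g) with h1 | h1 <;>
        rcases Int.units_eq_one_or (ε j) with h2 | h2 <;> simp_all

end RealizesSwaps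

end LevelActions

section IteratedPreimages

variable {K : Type} [Field K]

theorem aeval_fIter_succ {A : Type*} [CommRing A] [Algebra K A] (f : K[X]) (n : ℕ) (x : A) :
    aeval x (fIter f (n + 1)) = aeval (aeval x (fIter f n)) f := by
  rw [fIter, aeval_comp]

theorem aeval_fIter_add {A : Type*} [CommRing A] [Algebra K A] (f : K[X]) (m n : ℕ) (x : A) :
    aeval x (fIter f (m + n)) = aeval (aeval x (fIter f n)) (fIter f m) := by
  induction m with
  | zero => simp [fIter]
  | succ m ih => rw [Nat.add_right_comm, aeval_fIter_succ, ih, aeval_fIter_succ]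

theorem aeval_fIter_succ' {A : Type*} [CommRing A] [Algebra K A] (f : K[X]) (n : ℕ) (x : A) :
    aeval x (fIter f (n + 1)) = aeval (aeval x f) (fIter f n) := by
  rw [aeval_fIter_add, fIter, fIter, comp_X]

theorem natDegree_fIter (f : K[X]) (n : ℕ) : (fIter f n).natDegree = f.natDegree ^ n := by
  induction n with
  | zero => simp [fIter]
  | succ n ih => rw [fIter, natDegree_comp, ih, pow_succ']

theorem aeval_derivative_fIter {A : Type*} [CommRing A] [Algebra K A] (f : K[X]) (n : ℕ) (x : A) :
    aeval x (derivative (fIter f n)) =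
      ∏ k ∈ Finset.range n, aeval (aeval x (fIter f k)) (derivative f) := by
  induction n with
  | zero => simp [fIter]
  | succ n ih => rw [fIter, derivative_comp, map_mul, ih, aeval_comp, Finset.prod_range_succ]

theorem exists_aeval_eq {Ω : Type*} [Field Ω] [IsAlgClosed Ω] [Algebra K Ω] {q : K[X]}
    (hq : q.natDegree ≠ 0) (y : Ω) : ∃ z : Ω, aeval z q = y := by
  have hdeg : (q.map (algebraMap K Ω) - C y).degree ≠ 0 := by
    rw [degree_sub_C]
    · rw [degree_map]
      exact fun h => hq (natDegree_eq_of_degree_eq_some h)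
    · rw [degree_map]
      exact natDegree_pos_iff_degree_pos.1 (Nat.pos_of_ne_zero hq)
  obtain ⟨z, hz⟩ := IsAlgClosed.exists_root _ hdeg
  refine ⟨z, ?_⟩
  rwa [IsRoot, eval_sub, eval_C, eval_map_algebraMap, sub_eq_zero] at hz

theorem nodup_roots_of_derivative_ne_zero {Ω : Type*} [Field Ω] {q : Polynomial Ω}
    (hq : ∀ y, q.eval y = 0 → q.derivative.eval y ≠ 0) : q.roots.Nodup := by
  classical
  rw [Multiset.nodup_iff_count_le_one]
  intro y
  by_contra! hy
  rw [count_roots] at hy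
  have hq0 : q ≠ 0 := by
    rintro rfl
    simp at hy
  have h2 := (one_lt_rootMultiplicity_iff_isRoot hq0).1 hy
  exact hq y h2.1 h2.2

variable {f : K[X]} {α : K}

/-- The set of `i`-fold iterated preimages of `α` under `f` in an algebraic closure. -/
def preimageLevel (f : K[X]) (α : K) (i : ℕ) :
    SubMulAction Gal(AlgebraicClosure K/K) (AlgebraicClosure K) where
  carrier := {x | aeval x (fIter f i) = algebraMap K _ α}
  smul_mem' g x hx := by
    rw [Set.mem_ofPred_eq] at hx ⊢
    rw [AlgEquiv.smul_def, aeval_algHom_apply, hx, AlgEquiv.commutes]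

theorem mem_preimageLevel {i : ℕ} {x : AlgebraicClosure K} :
    x ∈ preimageLevel f α i ↔ aeval x (fIter f i) = algebraMap K _ α := Iff.rfl

/-- The map induced by `f` between consecutive levels of iterated preimages of `α`. -/
def preimageMap (f : K[X]) (α : K) (i : ℕ) (x : preimageLevel f α (i + 1)) :
    preimageLevel f α i :=
  ⟨aeval x.1 f, by
    rw [mem_preimageLevel, ← aeval_fIter_succ']
    exact x.2⟩

theorem preimageMap_smul (i : ℕ) (g : Gal(AlgebraicClosure K/K)) (x : preimageLevel f α (i + 1)) :
    preimageMap f α i (g • x) = g • preimageMap f α i x :=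
  Subtype.ext (aeval_algHom_apply g x.1 f)

instance : Unique (preimageLevel f α 0) where
  default := ⟨algebraMap K _ α, by simp [mem_preimageLevel, fIter]⟩
  uniq x := by
    have := x.2
    rw [mem_preimageLevel, fIter, aeval_X] at this
    exact Subtype.ext this

theorem fIter_sub_C_ne_zero (hf : f.natDegree ≠ 0) (i : ℕ) : fIter f i - C α ≠ 0 := by
  intro h
  have := congrArg natDegree h
  rw [natDegree_sub_C, natDegree_fIter] at this
  exact pow_ne_zero _ hf this

theorem mem_rootSet_iff_mem_preimageLevel (hf : f.natDegree ≠ 0) {i : ℕ}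
    {x : AlgebraicClosure K} :
    x ∈ (fIter f i - C α).rootSet (AlgebraicClosure K) ↔ x ∈ preimageLevel f α i := by
  rw [mem_rootSet, mem_preimageLevel, map_sub, aeval_C, sub_eq_zero]
  exact and_iff_right (fIter_sub_C_ne_zero hf i)

theorem finite_preimageLevel (hf : f.natDegree ≠ 0) (i : ℕ) : Finite (preimageLevel f α i) := by
  refine ((fIter f i - C α).rootSet_finite (AlgebraicClosure K)).subset fun x hx => ?_
  exact (mem_rootSet_iff_mem_preimageLevel hf).2 hx

theorem aeval_derivative_ne_zero (hf : f.natDegree ≠ 0) {n : ℕ}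
    (hsep : (fIter f n - C α).Separable) {j : ℕ} (hj : j < n) {y : AlgebraicClosure K}
    (hy : y ∈ preimageLevel f α (j + 1)) : aeval y (derivative f) ≠ 0 := by
  intro h0
  obtain ⟨m, rfl⟩ : ∃ m, n = (j + 1) + m := ⟨n - (j + 1), by omega⟩
  obtain ⟨z, rfl⟩ := exists_aeval_eq (q := fIter f m)
    (by rw [natDegree_fIter]; exact pow_ne_zero _ hf) y
  rw [mem_preimageLevel, ← aeval_fIter_add] at hy
  refine hsep.aeval_derivative_ne_zero (x := z) (by simp [hy]) ?_
  rw [derivative_sub, derivative_C, sub_zero, aeval_derivative_fIter]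
  exact Finset.prod_eq_zero (Finset.mem_range.2 (by omega)) h0

theorem card_fiber_preimageMap (hf : f.natDegree ≠ 0) {n : ℕ}
    (hsep : (fIter f n - C α).Separable) {i : ℕ} (hi : i < n) (x : preimageLevel f α i)
    [Fintype {y // preimageMap f α i y = x}] :
    Fintype.card {y // preimageMap f α i y = x} = f.natDegree := by
  classical
  set q : (AlgebraicClosure K)[X] := f.map (algebraMap K _) - C x.1 with hq
  have hdeg : q.natDegree = f.natDegree := by rw [hq, natDegree_sub_C, natDegree_map]
  have heval : ∀ y, q.eval y = 0 ↔ aeval y f = x.1 := by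
    intro y
    rw [hq, eval_sub, eval_C, eval_map_algebraMap, sub_eq_zero]
  have hmem : ∀ y, aeval y f = x.1 → y ∈ preimageLevel f α (i + 1) := by
    intro y hy
    rw [mem_preimageLevel, aeval_fIter_succ', hy]
    exact x.2
  have hnodup : q.roots.Nodup := by
    refine nodup_roots_of_derivative_ne_zero fun y hy => ?_
    rw [hq, derivative_sub, derivative_C, sub_zero, derivative_map, eval_map_algebraMap]
    exact aeval_derivative_ne_zero hf hsep hi (hmem y ((heval y).1 hy))
  have hq0 : q ≠ 0 := by
    intro h
    rw [h, natDegree_zero] at hdeg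
    exact hf hdeg.symm
  rw [← hdeg, (IsAlgClosed.splits q).natDegree_eq_card_roots,
    ← Multiset.toFinset_card_of_nodup hnodup, ← Fintype.card_coe]
  refine Fintype.card_congr
    { toFun := fun y => ⟨y.1.1, ?_⟩
      invFun := fun y => ⟨⟨y.1, ?_⟩, ?_⟩
      left_inv := fun y => rfl
      right_inv := fun y => rfl }
  · rw [Multiset.mem_toFinset, mem_roots hq0, IsRoot, heval]
    exact congrArg Subtype.val y.2
  · refine hmem _ ((heval _).1 ?_)
    exact (mem_roots hq0).1 (Multiset.mem_toFinset.1 y.2)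
  · exact Subtype.ext ((heval _).1 ((mem_roots hq0).1 (Multiset.mem_toFinset.1 y.2)))

theorem nodup_roots_fIter_sub_C (hf : f.natDegree ≠ 0) {n : ℕ}
    (hsep : (fIter f n - C α).Separable) {i : ℕ} (hi : i ≤ n) :
    ((fIter f i - C α).map (algebraMap K (AlgebraicClosure K))).roots.Nodup := by
  refine nodup_roots_of_derivative_ne_zero fun y hy => ?_
  rw [eval_map_algebraMap, map_sub, aeval_C, sub_eq_zero] at hy
  rw [derivative_map, eval_map_algebraMap, derivative_sub, derivative_C, sub_zero,
    aeval_derivative_fIter, Finset.prod_ne_zero_iff]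
  intro k hk
  rw [Finset.mem_range] at hk
  refine aeval_derivative_ne_zero hf hsep (j := i - k - 1) (by omega) ?_
  rw [mem_preimageLevel, ← aeval_fIter_add, show i - k - 1 + 1 + k = i by omega, hy]

theorem pairProd_eq_det_sq {F : Type} [Field F] (l : List F) :
    pairProd l = (Matrix.vandermonde l.get).det ^ 2 := by
  rw [pairProd, Matrix.det_vandermonde, ← Fin.prod_univ_eq_prod_range
    (fun i => ∏ j ∈ Finset.range i, (l.getD i 0 - l.getD j 0) ^ 2)]
  simp_rw [← Finset.prod_pow]
  rw [Finset.prod_comm' (t' := Finset.univ) (s' := fun j => Finset.Iio j) (by simp)]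
  refine Finset.prod_congr rfl fun i _ => ?_
  symm
  refine Finset.prod_bij (fun j _ => j.1) ?_ ?_ ?_ ?_
  · simp
  · exact fun a _ b _ h => Fin.ext h
  · intro b hb
    rw [Finset.mem_range] at hb
    exact ⟨⟨b, hb.trans i.2⟩, by simpa [Fin.lt_def] using hb, rfl⟩
  · intro a _
    simp

/-- A square root of the discriminant of `f^i - α` on which the Galois group acts through the sign
of the permutation of the roots. -/
theorem exists_sq_eq_polyDisc (hf : f.natDegree ≠ 0) {n : ℕ}
    (hsep : (fIter f n - C α).Separable) {i : ℕ} (hi : i ≤ n)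
    [∀ i, Fintype (preimageLevel f α i)] [∀ i, DecidableEq (preimageLevel f α i)] :
    ∃ δ : AlgebraicClosure K, δ ≠ 0 ∧ δ ^ 2 = polyDisc (fIter f i - C α) ∧
      ∀ g : Gal(AlgebraicClosure K/K),
        g δ = ((levelSign _ (fun i => preimageLevel f α i) i g : ℤ) : AlgebraicClosure K) * δ := by
  set P := fIter f i - C α with hP
  have hP0 : P ≠ 0 := fIter_sub_C_ne_zero hf i
  set l := ((P.map (algebraMap K (AlgebraicClosure K))).roots).toList with hl
  have hnodup : l.Nodup := by
    rw [← Multiset.coe_nodup, hl, Multiset.coe_toList]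
    exact nodup_roots_fIter_sub_C hf hsep hi
  have hmem : ∀ x, x ∈ l ↔ x ∈ preimageLevel f α i := by
    intro x
    rw [hl, Multiset.mem_toList, ← mem_rootSet_iff_mem_preimageLevel hf, mem_rootSet,
      mem_roots_map hP0, aeval_def]
    exact (and_iff_right hP0).symm
  have := Classical.decEq (AlgebraicClosure K)
  let e : Fin l.length ≃ preimageLevel f α i :=
    (List.Nodup.getEquiv l hnodup).trans (Equiv.subtypeEquivRight hmem)
  have he : ∀ k, (e k : AlgebraicClosure K) = l.get k := fun k => rfl
  refine ⟨algebraMap K _ (P.leadingCoeff ^ (P.natDegree - 1)) * (Matrix.vandermonde l.get).det,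
    mul_ne_zero ?_ ?_, ?_, fun g => ?_⟩
  · rw [Ne, FaithfulSMul.algebraMap_eq_zero_iff]
    exact pow_ne_zero _ (leadingCoeff_ne_zero.2 hP0)
  · exact Matrix.det_vandermonde_ne_zero_iff.2 (List.nodup_iff_injective_get.1 hnodup)
  · rw [polyDisc, ← hl, pairProd_eq_det_sq, mul_pow, map_pow, ← pow_mul, Nat.sub_mul, one_mul,
      mul_comm P.natDegree]
  · let π : Equiv.Perm (preimageLevel f α i) := MulAction.toPermHom _ _ g
    have hv : ∀ k, g (l.get k) = l.get (e.symm.permCongr π k) := by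
      intro k
      rw [← he, ← he]
      simp [π, Equiv.permCongr_apply]
    have hdet : g (Matrix.vandermonde l.get).det =
        ((Equiv.Perm.sign π : ℤ) : AlgebraicClosure K) * (Matrix.vandermonde l.get).det := by
      rw [← Equiv.Perm.sign_permCongr e.symm π, ← Matrix.det_permute, AlgEquiv.map_det]
      congr 1
      ext a b
      rw [AlgEquiv.mapMatrix_apply, Matrix.map_apply, Matrix.submatrix_apply,
        Matrix.vandermonde_apply, Matrix.vandermonde_apply, map_pow, hv, id]
    rw [map_mul, AlgEquiv.commutes, hdet, levelSign_apply, mul_left_comm]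

end IteratedPreimages

/-- The quadratic character whose kernel is a given subgroup of index two. -/
theorem exists_ker_eq_of_index_eq_two {G : Type*} [Group G] {H : Subgroup G} (hH : H.index = 2) :
    ∃ χ : G →* ℤˣ, χ.ker = H := by
  classical
  refine ⟨⟨⟨fun g => if g ∈ H then 1 else -1, if_pos H.one_mem⟩, fun a b => ?_⟩, ?_⟩
  · simp only [Subgroup.mul_mem_iff_of_index_two hH]
    by_cases ha : a ∈ H <;> by_cases hb : b ∈ H <;> simp [ha, hb]
  · ext g
    by_cases hg : g ∈ H <;> simp [MonoidHom.mem_ker, hg]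

theorem le_of_fixingSubgroup_le {k E : Type*} [Field k] [Field E] [Algebra k E] [IsGalois k E]
    {A B : IntermediateField k E} (h : B.fixingSubgroup ≤ A.fixingSubgroup) : A ≤ B := by
  rw [← InfiniteGalois.fixedField_fixingSubgroup B]
  exact (IntermediateField.le_iff_le _ _).2 h

theorem mem_fixingSubgroup_adjoin {k E : Type*} [Field k] [Field E] [Algebra k E] {S : Set E}
    {g : Gal(E/k)} : g ∈ (IntermediateField.adjoin k S).fixingSubgroup ↔ ∀ x ∈ S, g x = x := by
  rw [IntermediateField.mem_fixingSubgroup_iff]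
  exact IntermediateField.forall_mem_adjoin_smul_eq_self_iff k g

end Arb

open Arb in
/-- If `f^n - α` is separable and its splitting field `K_f^n(α)` has the
maximal possible degree `(d!)^{(d^n-1)/(d-1)}` over `K` (i.e. `Gal_f^n(α) ≅ [S_d]^n`), then the
field `L` obtained from `K` by adjoining the square roots of `disc(f^i - α)`, `1 ≤ i ≤ n`, is a
subfield of `K_f^n(α)` of degree `2^n` over `K`, and every quadratic subextension of
`K_f^n(α)/K` is contained in `L`. -/
theorem quadratic_subextensions {K : Type} [Field K] [NumberField K]
    (d : ℕ) (hd : 2 ≤ d) (f : K[X]) (hdeg : f.natDegree = d) (α : K) (n : ℕ) (hn : 1 ≤ n)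
    (hsep : (fIter f n - C α).Separable)
    (SF : IntermediateField K (AlgebraicClosure K))
    (hSF : SF = IntermediateField.adjoin K ((fIter f n - C α).rootSet (AlgebraicClosure K)))
    (hmax : Module.finrank K SF = (Nat.factorial d) ^ ((d ^ n - 1) / (d - 1)))
    (L : IntermediateField K (AlgebraicClosure K))
    (hL : L = IntermediateField.adjoin K
      {x : AlgebraicClosure K | ∃ i : ℕ, 1 ≤ i ∧ i ≤ n ∧ x ^ 2 = polyDisc (fIter f i - C α)}) :
    L ≤ SF ∧ Module.finrank K L = 2 ^ n ∧
      ∀ M : IntermediateField K (AlgebraicClosure K),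
        M ≤ SF → Module.finrank K M = 2 → M ≤ L := by
  classical
  have hf : f.natDegree ≠ 0 := by omega
  have : ∀ i, Finite (preimageLevel f α i) := finite_preimageLevel hf
  have : ∀ i, Fintype (preimageLevel f α i) := fun i => Fintype.ofFinite _
  let Γ := Gal(AlgebraicClosure K/K)
  let V : ℕ → Type := fun i => preimageLevel f α i
  have : Unique (V 0) := inferInstanceAs (Unique (preimageLevel f α 0))
  have hp : ∀ i (g : Γ) (x : V (i + 1)), preimageMap f α i (g • x) = g • preimageMap f α i x :=
    preimageMap_smul
  have hfib : ∀ i < n, ∀ x : V i,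
      Fintype.card {y : V (i + 1) // preimageMap f α i y = x} = d := fun i hi x =>
    (card_fiber_preimageMap hf hsep hi x).trans hdeg
  have hSFfix : SF.fixingSubgroup = levelKer Γ V n := by
    ext g
    rw [hSF, mem_fixingSubgroup_adjoin, mem_levelKer]
    simp only [mem_rootSet_iff_mem_preimageLevel hf]
    exact ⟨fun h x => Subtype.ext (h x.1 x.2), fun h x hx => congrArg Subtype.val (h ⟨x, hx⟩)⟩
  have hindex : (levelKer Γ V n).index = ∏ i ∈ Finset.range n, d.factorial ^ d ^ i := by
    rw [← hSFfix, ← IntermediateField.finrank_eq_fixingSubgroup_index, hmax,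
      Finset.prod_pow_eq_pow_sum, Nat.geomSum_eq hd]
  have hswap : RealizesSwaps Γ (V := V) (preimageMap f α) n :=
    realizesSwaps_of_index_eq hp (by omega) hfib hindex
  have hLfix : ∀ g : Γ, g ∈ L.fixingSubgroup ↔ ∀ j < n, levelSign Γ V (j + 1) g = 1 := by
    intro g
    have hsign (i : ℕ) (hi : i ≤ n) : (∀ x, x ^ 2 = polyDisc (fIter f i - C α) → g x = x) ↔
        levelSign Γ V i g = 1 := by
      obtain ⟨δ, hδ0, hδ, hg⟩ := exists_sq_eq_polyDisc hf hsep hi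
      have hgδ : g δ = δ ↔ levelSign Γ V i g = 1 := by
        rw [hg g]
        rcases Int.units_eq_one_or (levelSign Γ V i g) with h | h
        · exact iff_of_true (by rw [h]; simp) h
        · refine iff_of_false (fun hδ' => ?_) (by rw [h]; decide)
          rw [h] at hδ'
          simp [neg_eq_self, hδ0] at hδ'
      rw [← hgδ]
      refine ⟨fun h => h δ hδ, fun h x hx => ?_⟩
      rcases sq_eq_sq_iff_eq_or_eq_neg.1 (hx.trans hδ.symm) with rfl | rfl
      · exact h
      · rw [map_neg, h]
    rw [hL, mem_fixingSubgroup_adjoin]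
    constructor
    · exact fun h j hj => (hsign (j + 1) hj).1 fun x hx => h x ⟨j + 1, by omega, hj, hx⟩
    · rintro h x ⟨i, hi1, hin, hx⟩
      obtain ⟨j, rfl⟩ : ∃ j, i = j + 1 := ⟨i - 1, by omega⟩
      exact (hsign (j + 1) hin).2 (h j hin) x hx
  refine ⟨le_of_fixingSubgroup_le fun g hg => ?_, ?_, fun M hM hM2 =>
    le_of_fixingSubgroup_le fun g hg => ?_⟩
  · rw [hSFfix] at hg
    exact (hLfix g).2 fun j hj =>
      levelSign_eq_one_of_mem (levelKer_le hp (by omega) hfib hj le_rfl hg)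
  · let S : Γ →* (Fin n → ℤˣ) := MonoidHom.pi fun j => levelSign Γ V (j + 1)
    have hker : L.fixingSubgroup = S.ker := by
      ext g
      rw [hLfix, MonoidHom.mem_ker, funext_iff, Fin.forall_iff]
      rfl
    have hsurj : Function.Surjective S := by
      intro ε
      obtain ⟨g, hg⟩ := hswap.exists_levelSign_eq hp hd hfib
        (fun j => if h : j < n then ε ⟨j, h⟩ else 1) le_rfl
      refine ⟨g, funext fun j => ?_⟩
      exact (hg j j.2).trans (dif_pos j.2)
    rw [IntermediateField.finrank_eq_fixingSubgroup_index, hker, Subgroup.index_ker,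
      MonoidHom.range_eq_top.2 hsurj, Subgroup.card_top, Nat.card_eq_fintype_card]
    simp
  · rw [IntermediateField.finrank_eq_fixingSubgroup_index] at hM2
    obtain ⟨χ, hχ⟩ := exists_ker_eq_of_index_eq_two hM2
    rw [← hχ]
    refine hswap.eq_one_of_levelSign hp le_rfl ?_ ((hLfix g).1 hg)
    rw [hχ, ← hSFfix]
    exact IntermediateField.fixingSubgroup_le hM
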